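/- Fix k ≥ 0 and α ∈ ℝ, let F₂(x,v) = −kxv²/(1 + kx²) − α²x/(1 + kx²)³ and H(x,v) = F₂(x,v)/v. On the open set M = {(x,v,w) ∈ ℝ³ : v ≠ 0} define the vector fields X_H(x,v,w) = (v, F₂(x,v), H(x,v)) and Y(x,v,w) = eʷ·(1, H(x,v), H(x,v)/v). Then: (i) the function g(x,v,w) = eʷ/v satisfies X_H g = 0 on M, i.e. v·∂g/∂x + F₂·∂g/∂v + H·∂g/∂w = 0 there; (ii) Y = g·X_H, and the Lie bracket [Y, X_H] vanishes identically on M (where [V,W](p) = DW(p)·V(p) − DV(p)·W(p)). Hence Y is a non-local symmetry of the second nonlinear oscillator. -/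

import Mathlib

open VectorField in
/-- A vector field `V` commutes with `f • V` whenever `f` is a first integral of `V`. -/
theorem lieBracket_smul_self_eq_zero {E : Type*} [NormedAddCommGroup E] [NormedSpace ℝ E]
    {V : E → E} {f : E → ℝ} {x : E} (hf : DifferentiableAt ℝ f x) (hV : DifferentiableAt ℝ V x)
    (h : fderiv ℝ f x (V x) = 0) : lieBracket ℝ (fun y ↦ f y • V y) V x = 0 := by
  have := lieBracket_smul_left (W := V) hf hV
  simpa [h, Pi.smul_def'] using this

theorem hasFDerivAt_exp_div {p : ℝ × ℝ × ℝ} (hp : p.2.1 ≠ 0) :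
    ∃ g' : ℝ × ℝ × ℝ →L[ℝ] ℝ,
      HasFDerivAt (fun q : ℝ × ℝ × ℝ ↦ Real.exp q.2.2 / q.2.1) g' p ∧
      ∀ a b c : ℝ, g' (a, b, c) = Real.exp p.2.2 * (c / p.2.1 - b / p.2.1 ^ 2) := by
  have hw : HasFDerivAt (fun q : ℝ × ℝ × ℝ ↦ q.2.2) _ p :=
    (hasFDerivAt_snd (𝕜 := ℝ)).comp p hasFDerivAt_snd
  have hv : HasFDerivAt (fun q : ℝ × ℝ × ℝ ↦ q.2.1) _ p :=
    (hasFDerivAt_fst (𝕜 := ℝ)).comp p hasFDerivAt_snd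
  refine ⟨_, hw.exp.mul ((hasDerivAt_inv hp).comp_hasFDerivAt p hv), fun a b c ↦ ?_⟩
  simp
  field_simp
  ring


/-- Non-local symmetry of the second nonlinear oscillator. With
`F₂(x,v) = −kxv²/(1+kx²) − α²x/(1+kx²)³`, `H = F₂/v`, on
`M = {(x,v,w) : v ≠ 0} ⊂ ℝ³` consider `X_H = (v, F₂, H)` and
`Y = eʷ·(1, H, H/v)`. Then `g(x,v,w) = eʷ/v` satisfies `X_H g = 0` on `M`,
`Y = g·X_H` on `M`, and the Lie bracket `[Y, X_H]` vanishes identically on `M`;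
hence `Y` is a non-local symmetry of the second nonlinear oscillator. -/
theorem nonlocal_symmetry_second_oscillator
    (k α : ℝ) (hk : 0 ≤ k) (F₂ H : ℝ → ℝ → ℝ)
    (hF : ∀ x v : ℝ, F₂ x v =
      -(k * x * v ^ 2 / (1 + k * x ^ 2)) - α ^ 2 * x / (1 + k * x ^ 2) ^ 3)
    (hH : ∀ x v : ℝ, H x v = F₂ x v / v)
    (XH Y : ℝ × ℝ × ℝ → ℝ × ℝ × ℝ)
    (hXH : ∀ p : ℝ × ℝ × ℝ, XH p = (p.2.1, F₂ p.1 p.2.1, H p.1 p.2.1))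
    (hY : ∀ p : ℝ × ℝ × ℝ,
      Y p = Real.exp p.2.2 • ((1 : ℝ), H p.1 p.2.1, H p.1 p.2.1 / p.2.1))
    (g : ℝ × ℝ × ℝ → ℝ)
    (hg : ∀ p : ℝ × ℝ × ℝ, g p = Real.exp p.2.2 / p.2.1) :
    (∀ x v w : ℝ, v ≠ 0 →
      v * deriv (fun x' => g (x', v, w)) x
        + F₂ x v * deriv (fun v' => g (x, v', w)) v
        + H x v * deriv (fun w' => g (x, v, w')) w = 0)
    ∧ (∀ p : ℝ × ℝ × ℝ, p.2.1 ≠ 0 → Y p = g p • XH p)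
    ∧ (∀ p : ℝ × ℝ × ℝ, p.2.1 ≠ 0 →
        fderiv ℝ XH p (Y p) - fderiv ℝ Y p (XH p) = 0) := by
  have hF' : ∀ x v : ℝ, v ≠ 0 → H x v * v = F₂ x v := fun x v hv ↦ by
    rw [hH, div_mul_cancel₀ _ hv]
  have hYg : ∀ p : ℝ × ℝ × ℝ, p.2.1 ≠ 0 → Y p = g p • XH p := fun p hp ↦ by
    rw [hY, hg, hXH, ← hF' _ _ hp]
    ext <;> simp <;> field_simp
  refine ⟨fun x v w hv ↦ ?_, hYg, fun p hp ↦ ?_⟩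
  · have hdv : HasDerivAt (fun v' ↦ Real.exp w / v') (-(Real.exp w) / v ^ 2) v := by
      simpa using (hasDerivAt_const v (Real.exp w)).fun_div (hasDerivAt_id v) hv
    have hdw : HasDerivAt (fun w' ↦ Real.exp w' / v) (Real.exp w / v) w :=
      (Real.hasDerivAt_exp w).div_const v
    simp only [hg, deriv_const, hdv.deriv, hdw.deriv, ← hF' x v hv]
    field_simp
    ring
  · obtain rfl : g = fun q ↦ Real.exp q.2.2 / q.2.1 := funext hg
    have hk' : ∀ x : ℝ, 1 + k * x ^ 2 ≠ 0 := fun x ↦ by positivity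
    have hX : DifferentiableAt ℝ XH p := by
      rw [show XH = _ from funext hXH]
      simp only [hH, hF]
      fun_prop (disch := first | assumption | exact hk' _ | exact pow_ne_zero _ (hk' _))
    obtain ⟨g', hg', hg'_apply⟩ := hasFDerivAt_exp_div hp
    have hX_g : fderiv ℝ (fun q : ℝ × ℝ × ℝ ↦ Real.exp q.2.2 / q.2.1) p (XH p) = 0 := by
      rw [hg'.fderiv, hXH, hg'_apply, ← hF' _ _ hp]
      field_simp
      ring
    have hev : Y =ᶠ[nhds p] fun q ↦ (Real.exp q.2.2 / q.2.1) • XH q := by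
      filter_upwards [(continuous_fst.comp continuous_snd).continuousAt.eventually_ne hp]
        with q hq using hYg q hq
    have := lieBracket_smul_self_eq_zero hg'.differentiableAt hX hX_g
    rwa [← hev.lieBracket_vectorField_eq Filter.EventuallyEq.rfl] at this
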